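/- Let A and B be n×n positive semidefinite complex matrices, X an arbitrary n×n complex matrix, and let t be a real number with 0 ≤ t ≤ 1. Then ‖A^{1−t}XB^t − A^tXB^{1−t}‖ ≤ |1 − 2t| · ‖AX − XB‖, where ‖·‖ denotes the operator norm induced by the Euclidean norm on ℂⁿ. (Corollary 2.6, instance for the operator norm) -/

import Mathlib

open scoped ComplexOrder

/-- Matrix power of a positive semidefinite matrix via the continuous functional calculus
(equivalently, raising each eigenvalue to the power `v` in a spectral decomposition). -/
noncomputable def mpow {n : ℕ} (A : Matrix (Fin n) (Fin n) ℂ) (v : ℝ) :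
    Matrix (Fin n) (Fin n) ℂ :=
  cfc (fun x : ℝ => x ^ v) A

/-- The Frobenius norm of a complex matrix. -/
noncomputable def frobNorm {n : ℕ} (M : Matrix (Fin n) (Fin n) ℂ) : ℝ :=
  Real.sqrt (∑ i, ∑ j, ‖M i j‖ ^ 2)

/-- The operator norm of a complex matrix induced by the Euclidean norm on `ℂⁿ`. -/
noncomputable def l2OpNorm {n : ℕ} (M : Matrix (Fin n) (Fin n) ℂ) : ℝ :=
  ‖Matrix.toEuclideanCLM (𝕜 := ℂ) M‖

lemma mpow_eq_conj_diagonal {n : ℕ} {C : Matrix (Fin n) (Fin n) ℂ} (hC : C.IsHermitian) (s : ℝ) :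
    mpow C s = hC.eigenvectorUnitary * Matrix.diagonal (fun i => ((hC.eigenvalues i ^ s : ℝ) : ℂ))
      * star (hC.eigenvectorUnitary : Matrix (Fin n) (Fin n) ℂ) := by
  rw [mpow, hC.cfc_eq, Matrix.IsHermitian.cfc, Unitary.conjStarAlgAut_apply]
  rfl

lemma mpow_one {n : ℕ} {C : Matrix (Fin n) (Fin n) ℂ} (hC : C.IsHermitian) : mpow C 1 = C := by
  conv_rhs => rw [hC.spectral_theorem, Unitary.conjStarAlgAut_apply]
  simp only [mpow_eq_conj_diagonal hC, Real.rpow_one]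
  rfl

lemma mpow_zero {n : ℕ} {C : Matrix (Fin n) (Fin n) ℂ} (hC : C.IsHermitian) : mpow C 0 = 1 := by
  simp [mpow_eq_conj_diagonal hC]

section HeinzDifference

open Filter Topology Matrix
open scoped Matrix.Norms.L2Operator

/-- For self-adjoint `H` and `K`, the map `Y ↦ Y + i (H Y - Y K)` does not decrease the operator
norm. -/
lemma norm_le_norm_add_I_smul_commutator {E : Type*} [NormedAddCommGroup E]
    [InnerProductSpace ℂ E] [FiniteDimensional ℂ E] [CompleteSpace E] (H K Y : E →L[ℂ] E)
    (hH : IsSelfAdjoint H) (hK : IsSelfAdjoint K) :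
    ‖Y‖ ≤ ‖Y + Complex.I • (H * Y - Y * K)‖ := by
  have : ProperSpace E := FiniteDimensional.proper ℂ E
  obtain ⟨v, hv, hmax⟩ := (isCompact_closedBall (0 : E) 1).exists_isMaxOn
    ⟨0, by simp⟩ (f := fun w => ‖Y w‖) (by fun_prop)
  have hv1 : ‖v‖ ≤ 1 := by simpa using hv
  have hYv : ‖Y v‖ = ‖Y‖ := by
    refine le_antisymm ((Y.le_opNorm v).trans (mul_le_of_le_one_right (norm_nonneg _) hv1)) ?_
    refine ContinuousLinearMap.opNorm_le_of_unit_norm (norm_nonneg _) fun x hx => ?_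
    exact hmax (by simp [hx])
  have hadj : ContinuousLinearMap.adjoint Y (Y v) = ((‖Y‖ ^ 2 : ℝ) : ℂ) • v := by
    have hinner : RCLike.re (inner ℂ (ContinuousLinearMap.adjoint Y (Y v))
        (((‖Y‖ ^ 2 : ℝ) : ℂ) • v)) = ‖Y‖ ^ 2 * ‖Y‖ ^ 2 := by
      rw [inner_smul_right, ContinuousLinearMap.adjoint_inner_left, inner_self_eq_norm_sq_to_K, hYv]
      simp [← Complex.ofReal_pow]
    have hbound : ‖ContinuousLinearMap.adjoint Y (Y v)‖ ≤ ‖Y‖ * ‖Y‖ := by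
      simpa [hYv] using (ContinuousLinearMap.adjoint Y).le_opNorm (Y v)
    have hsmul : ‖((‖Y‖ ^ 2 : ℝ) : ℂ) • v‖ ≤ ‖Y‖ * ‖Y‖ := by
      rw [norm_smul, Complex.norm_of_nonneg (sq_nonneg _), ← sq]
      exact mul_le_of_le_one_right (sq_nonneg _) hv1
    have hsq := @norm_sub_sq ℂ E _ _ _ (ContinuousLinearMap.adjoint Y (Y v))
      (((‖Y‖ ^ 2 : ℝ) : ℂ) • v)
    rw [hinner] at hsq
    have h1 := pow_le_pow_left₀ (norm_nonneg _) hbound 2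
    have h2 := pow_le_pow_left₀ (norm_nonneg _) hsmul 2
    rw [← sub_eq_zero, ← norm_eq_zero]
    exact pow_eq_zero_iff two_ne_zero |>.mp (le_antisymm (by linarith) (sq_nonneg _))
  have hZ : (inner ℂ (Y v) ((Y + Complex.I • (H * Y - Y * K)) v)).re = ‖Y‖ ^ 2 := by
    have h1 : (inner ℂ (Y v) (H (Y v))).im = 0 :=
      (ContinuousLinearMap.isSelfAdjoint_iff_isSymmetric.mp hH).im_inner_self_apply _
    have h2 : (inner ℂ v (K v)).im = 0 :=
      (ContinuousLinearMap.isSelfAdjoint_iff_isSymmetric.mp hK).im_inner_self_apply _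
    have h3 : inner ℂ (Y v) (Y (K v)) = ((‖Y‖ ^ 2 : ℝ) : ℂ) * inner ℂ v (K v) := by
      rw [← ContinuousLinearMap.adjoint_inner_left, hadj, inner_smul_left, Complex.conj_ofReal]
    simp only [_root_.add_apply, _root_.smul_apply, _root_.sub_apply,
      mul_apply_eq_comp, inner_add_right, inner_smul_right, inner_sub_right, h3,
      inner_self_eq_norm_sq_to_K, hYv]
    simp [h1, h2, ← Complex.ofReal_pow]
  have hle : ‖Y‖ ^ 2 ≤ ‖Y‖ * ‖Y + Complex.I • (H * Y - Y * K)‖ := by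
    rw [← hZ]
    refine (Complex.re_le_norm _).trans ((norm_inner_le_norm _ _).trans ?_)
    rw [hYv]
    gcongr
    exact (ContinuousLinearMap.le_opNorm _ _).trans
      (mul_le_of_le_one_right (norm_nonneg _) hv1)
  rcases (norm_nonneg Y).eq_or_lt with h0 | h0
  · rw [← h0]; exact norm_nonneg _
  · exact le_of_mul_le_mul_left (by rwa [sq] at hle) h0

variable {m : Type*} [Fintype m] [DecidableEq m]

lemma norm_le_norm_one_add_I_mul_sub (h k : m → ℝ) (Y : Matrix m m ℂ) :
    ‖Y‖ ≤ ‖of fun i j => (1 + Complex.I * (h i - k j)) * Y i j‖ := by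
  have hsa (d : m → ℝ) :
      IsSelfAdjoint (toEuclideanCLM (𝕜 := ℂ) (diagonal fun i => (d i : ℂ))) := by
    rw [isSelfAdjoint_iff, ← map_star]
    simp [star_eq_conjTranspose, diagonal_conjTranspose, Pi.star_def]
  have key := norm_le_norm_add_I_smul_commutator _ _ (toEuclideanCLM (𝕜 := ℂ) Y) (hsa h) (hsa k)
  rw [← map_mul, ← map_mul, ← map_sub, ← map_smul, ← map_add, l2_opNorm_toEuclideanCLM,
    l2_opNorm_toEuclideanCLM] at key
  refine key.trans_eq (congrArg norm (Matrix.ext fun i j => ?_))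
  simp [diagonal_mul, mul_diagonal]
  ring

lemma norm_le_norm_one_add_sq_sub (h k : m → ℝ) (Y : Matrix m m ℂ) :
    ‖Y‖ ≤ ‖of fun i j => (1 + (h i - k j) ^ 2 : ℂ) * Y i j‖ := by
  refine (norm_le_norm_one_add_I_mul_sub h k Y).trans
    ((norm_le_norm_one_add_I_mul_sub (-h) (-k) _).trans_eq ?_)
  congr 1
  ext i j
  simp only [of_apply, Pi.neg_apply, Complex.ofReal_neg]
  linear_combination -(h i - k j : ℂ) ^ 2 * Y i j * Complex.I_sq

lemma norm_one_add_smul_sq_sub_le {a : ℝ} (ha : a ^ 2 ≤ 1) (h k : m → ℝ) (Y : Matrix m m ℂ) :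
    ‖of fun i j => (1 + (a * (h i - k j)) ^ 2 : ℂ) * Y i j‖ ≤
      ‖of fun i j => (1 + (h i - k j) ^ 2 : ℂ) * Y i j‖ := by
  set Z : Matrix m m ℂ := of fun i j => (1 + (h i - k j) ^ 2 : ℂ) * Y i j with hZ
  have heq : (of fun i j => (1 + (a * (h i - k j)) ^ 2 : ℂ) * Y i j) =
      ((a ^ 2 : ℝ) : ℂ) • Z + ((1 - a ^ 2 : ℝ) : ℂ) • Y := by
    ext i j
    simp [hZ]
    ring
  rw [heq]
  refine (norm_add_le _ _).trans ?_
  rw [norm_smul, norm_smul, Complex.norm_of_nonneg (sq_nonneg a),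
    Complex.norm_of_nonneg (sub_nonneg.mpr ha)]
  nlinarith [norm_le_norm_one_add_sq_sub h k Y]

lemma norm_prod_one_add_smul_sq_sub_le {a : ℝ} (ha : a ^ 2 ≤ 1) (h k : m → ℝ) (N : ℕ)
    (Y : Matrix m m ℂ) :
    ‖of fun i j => (∏ l ∈ Finset.range N, (1 + (a * (h i - k j) / (l + 1)) ^ 2 : ℂ)) * Y i j‖ ≤
      ‖of fun i j => (∏ l ∈ Finset.range N, (1 + ((h i - k j) / (l + 1)) ^ 2 : ℂ)) * Y i j‖ := by
  induction N generalizing Y with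
  | zero => simp
  | succ N ih =>
    have step := norm_one_add_smul_sq_sub_le ha (fun i => h i / (N + 1)) (fun j => k j / (N + 1))
      (of fun i j => (∏ l ∈ Finset.range N, (1 + ((h i - k j) / (l + 1)) ^ 2 : ℂ)) * Y i j)
    have ih' := ih (of fun i j => (1 + (a * (h i - k j) / (N + 1)) ^ 2 : ℂ) * Y i j)
    calc _ = _ := congrArg norm (Matrix.ext fun i j => by
          simp only [of_apply, Finset.prod_range_succ, mul_assoc])
      _ ≤ _ := ih'
      _ = _ := congrArg norm (Matrix.ext fun i j => by
          simp only [of_apply]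
          push_cast
          ring)
      _ ≤ _ := step
      _ = _ := congrArg norm (Matrix.ext fun i j => by
          simp only [of_apply, Finset.prod_range_succ]
          push_cast
          ring)

lemma tendsto_euler_sinh_prod (z : ℂ) :
    Tendsto (fun N : ℕ => Real.pi * z * ∏ l ∈ Finset.range N, (1 + (z / (l + 1)) ^ 2)) atTop
      (𝓝 (Complex.sinh (Real.pi * z))) := by
  have key := (Complex.tendsto_euler_sin_prod (z * Complex.I)).mul_const (-Complex.I)
  rw [← mul_assoc, Complex.sin_mul_I] at key
  convert key using 2 with N
  · have : ∀ l : ℕ, 1 - (z * Complex.I) ^ 2 / ((l : ℂ) + 1) ^ 2 = 1 + (z / (l + 1)) ^ 2 := by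
      intro l
      rw [mul_pow, Complex.I_sq, div_pow]
      ring
    simp only [this]
    linear_combination (-Real.pi * z * ∏ l ∈ Finset.range N, (1 + (z / (l + 1)) ^ 2)) *
      -Complex.I_sq
  · linear_combination -Complex.sinh (Real.pi * z) * -Complex.I_sq

/-- The Schur multiplier `sinh (a x) / sinh x` in the differences `x = h i - k j` has norm at most
`|a|`. -/
lemma norm_sinh_smul_sub_le {a : ℝ} (ha : a ^ 2 ≤ 1) (h k : m → ℝ) (Y : Matrix m m ℂ) :
    ‖of fun i j => Complex.sinh (a * (h i - k j)) * Y i j‖ ≤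
      |a| * ‖of fun i j => Complex.sinh (h i - k j) * Y i j‖ := by
  have hpi : (Real.pi : ℂ) ≠ 0 := by exact_mod_cast Real.pi_ne_zero
  have hlim (c : ℝ) : Tendsto (fun N : ℕ => ‖of fun i j => (Real.pi * (c * (h i - k j) / Real.pi) *
      ∏ l ∈ Finset.range N, (1 + (c * (h i - k j) / Real.pi / (l + 1)) ^ 2 : ℂ)) * Y i j‖) atTop
      (𝓝 ‖of fun i j => Complex.sinh (c * (h i - k j)) * Y i j‖) := by
    refine Tendsto.norm (tendsto_pi_nhds.mpr fun i => tendsto_pi_nhds.mpr fun j => ?_)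
    simp only [of_apply]
    convert (tendsto_euler_sinh_prod (c * (h i - k j) / Real.pi)).mul_const (Y i j) using 3
    rw [mul_div_cancel₀ _ hpi]
  have h1 := (hlim 1).const_mul |a|
  simp only [Complex.ofReal_one, one_mul] at h1
  refine le_of_tendsto_of_tendsto' (hlim a) h1 fun N => ?_
  have key := norm_prod_one_add_smul_sq_sub_le ha (fun i => h i / Real.pi) (fun j => k j / Real.pi)
    N (of fun i j => (h i - k j : ℂ) * Y i j)
  calc _ = ‖(a : ℂ) • of fun i j => (∏ l ∈ Finset.range N,
        (1 + (a * ((h i / Real.pi : ℝ) - (k j / Real.pi : ℝ)) / (l + 1)) ^ 2 : ℂ)) *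
          (of fun i j => (h i - k j : ℂ) * Y i j) i j‖ := by
        congr 1
        ext i j
        simp only [of_apply, Matrix.smul_apply, smul_eq_mul, mul_div_cancel₀ _ hpi]
        push_cast
        simp only [← sub_div, mul_div_assoc]
        ring
    _ ≤ _ := by
        rw [norm_smul, Complex.norm_real, Real.norm_eq_abs]
        refine mul_le_mul_of_nonneg_left (key.trans_eq ?_) (abs_nonneg a)
        congr 1
        ext i j
        simp only [of_apply, mul_div_cancel₀ _ hpi]
        push_cast
        simp only [← sub_div]
        ring

lemma norm_heinz_diff_le_of_pos {t : ℝ} (ht0 : 0 ≤ t) (ht1 : t ≤ 1) {a b : m → ℝ}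
    (ha : ∀ i, 0 < a i) (hb : ∀ j, 0 < b j) (Y : Matrix m m ℂ) :
    ‖of fun i j => ((a i ^ (1 - t) * b j ^ t - a i ^ t * b j ^ (1 - t) : ℝ) : ℂ) * Y i j‖ ≤
      |1 - 2 * t| * ‖of fun i j => ((a i - b j : ℝ) : ℂ) * Y i j‖ := by
  have hsinh (s : ℝ) (i j : m) : a i ^ (1 - s) * b j ^ s - a i ^ s * b j ^ (1 - s) =
      Real.sinh ((1 - 2 * s) * (Real.log (a i) / 2 - Real.log (b j) / 2)) *
        (2 * Real.exp (Real.log (a i) / 2 + Real.log (b j) / 2)) := by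
    rw [Real.sinh_eq, Real.rpow_def_of_pos (ha i), Real.rpow_def_of_pos (ha i),
      Real.rpow_def_of_pos (hb j), Real.rpow_def_of_pos (hb j), ← Real.exp_add, ← Real.exp_add,
      div_mul_eq_mul_div, mul_left_comm, mul_div_cancel_left₀ _ two_ne_zero, sub_mul,
      ← Real.exp_add, ← Real.exp_add]
    ring_nf
  have key := norm_sinh_smul_sub_le (a := 1 - 2 * t) (by nlinarith)
    (fun i => Real.log (a i) / 2) (fun j => Real.log (b j) / 2)
    (of fun i j =>
      ((2 * Real.exp (Real.log (a i) / 2 + Real.log (b j) / 2) : ℝ) : ℂ) * Y i j)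
  have hsub (i j : m) : a i - b j = Real.sinh (Real.log (a i) / 2 - Real.log (b j) / 2) *
      (2 * Real.exp (Real.log (a i) / 2 + Real.log (b j) / 2)) := by
    simpa using hsinh 0 i j
  simp only [hsinh, hsub]
  simpa [mul_assoc] using key

lemma norm_heinz_diff_le_of_nonneg {t : ℝ} (ht0 : 0 ≤ t) (ht1 : t ≤ 1) {a b : m → ℝ}
    (ha : ∀ i, 0 ≤ a i) (hb : ∀ j, 0 ≤ b j) (Y : Matrix m m ℂ) :
    ‖of fun i j => ((a i ^ (1 - t) * b j ^ t - a i ^ t * b j ^ (1 - t) : ℝ) : ℂ) * Y i j‖ ≤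
      |1 - 2 * t| * ‖of fun i j => ((a i - b j : ℝ) : ℂ) * Y i j‖ := by
  let F (s ε : ℝ) : Matrix m m ℂ := of fun i j => (((a i + ε) ^ (1 - s) * (b j + ε) ^ s -
    (a i + ε) ^ s * (b j + ε) ^ (1 - s) : ℝ) : ℂ) * Y i j
  have hF {s : ℝ} (hs0 : 0 ≤ s) (hs1 : s ≤ 1) : Tendsto (fun ε => ‖F s ε‖) (𝓝[>] 0) (𝓝 ‖F s 0‖) := by
    have h1s : 0 ≤ 1 - s := sub_nonneg.mpr hs1
    have hcont : Continuous (F s) := by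
      refine continuous_matrix fun i j => ?_
      have hr {r : ℝ} (hr : 0 ≤ r) (c : ℝ) : Continuous fun ε : ℝ => (c + ε) ^ r :=
        (Real.continuous_rpow_const hr).comp (by fun_prop)
      exact (Complex.continuous_ofReal.comp (((hr h1s _).mul (hr hs0 _)).sub
        ((hr hs0 _).mul (hr h1s _)))).mul continuous_const
    exact (hcont.norm.tendsto 0).mono_left nhdsWithin_le_nhds
  have key := le_of_tendsto_of_tendsto (hF ht0 ht1)
    ((hF le_rfl zero_le_one).const_mul |1 - 2 * t|) (by
      filter_upwards [self_mem_nhdsWithin] with ε hε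
      have hε' : 0 < ε := hε
      simpa [F] using norm_heinz_diff_le_of_pos ht0 ht1 (fun i => add_pos_of_nonneg_of_pos (ha i) hε')
        (fun j => add_pos_of_nonneg_of_pos (hb j) hε') Y)
  simpa [F] using key

end HeinzDifference

/-- Corollary 2.6 for the operator norm. -/
theorem heinz_diff_le_commutator_opNorm (n : ℕ) (A B X : Matrix (Fin n) (Fin n) ℂ)
    (hA : A.PosSemidef) (hB : B.PosSemidef) (t : ℝ) (ht0 : 0 ≤ t) (ht1 : t ≤ 1) :
    l2OpNorm (mpow A (1 - t) * X * mpow B t - mpow A t * X * mpow B (1 - t)) ≤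
      |1 - 2 * t| * l2OpNorm (A * X - X * B) := by
  open scoped Matrix.Norms.L2Operator in
  set a := hA.1.eigenvalues
  set b := hB.1.eigenvalues
  set U := hA.1.eigenvectorUnitary
  set V := hB.1.eigenvectorUnitary
  set Y : Matrix (Fin n) (Fin n) ℂ := star (U : Matrix (Fin n) (Fin n) ℂ) * X * V with hY
  have hdiff (s : ℝ) : l2OpNorm (mpow A (1 - s) * X * mpow B s - mpow A s * X * mpow B (1 - s)) =
      ‖Matrix.of fun i j =>
        ((a i ^ (1 - s) * b j ^ s - a i ^ s * b j ^ (1 - s) : ℝ) : ℂ) * Y i j‖ := by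
    have hUX (D E : Matrix (Fin n) (Fin n) ℂ) :
        U * D * star (U : Matrix (Fin n) (Fin n) ℂ) * X *
          (V * E * star (V : Matrix (Fin n) (Fin n) ℂ)) =
        U * (D * Y * E) * star (V : Matrix (Fin n) (Fin n) ℂ) := by
      simp only [hY, mul_assoc]
    rw [l2OpNorm, Matrix.l2_opNorm_toEuclideanCLM, mpow_eq_conj_diagonal hA.1,
      mpow_eq_conj_diagonal hA.1, mpow_eq_conj_diagonal hB.1, mpow_eq_conj_diagonal hB.1, hUX, hUX, ← sub_mul, ← mul_sub, ← Unitary.coe_star, CStarRing.norm_mul_coe_unitary,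
      CStarRing.norm_coe_unitary_mul]
    congr 1
    ext i j
    simp [Matrix.diagonal_mul, Matrix.mul_diagonal, a, b]
    ring
  have hcomm := hdiff 0
  simp only [sub_zero, mpow_one hA.1, mpow_one hB.1, mpow_zero hA.1, mpow_zero hB.1, mul_one,
    one_mul, Real.rpow_one, Real.rpow_zero] at hcomm
  rw [hdiff t, hcomm]
  exact norm_heinz_diff_le_of_nonneg ht0 ht1 hA.eigenvalues_nonneg hB.eigenvalues_nonneg Y
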